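/- arXiv:2402.16623 — 3 statements merged into one kernel-verified Lean document; each statement's English description precedes it below -/
import Mathlib

section
/- If r̃ ≥ 1 and η̃ = r̃β̃ − (M+2)/2 > 0, then the function G₀(x, ν) = (1/(2ν))‖Fx − y‖₂² + (ν/ϑ̃)^{r̃} − η̃ log ν is convex on ℝ^N × ℝ_{++}; in particular, for every (x, ν) in this region, every u ∈ ℝ^N and every v ∈ ℝ, the Hessian quadratic form satisfies (u, v)ᵀ H_{G₀}(x, ν) (u, v) = ν^{-1} ‖Fu − v ν^{-1}(Fx − y)‖₂² + v² (η̃ ν^{-2} + (r̃(r̃−1)/ϑ̃^{r̃}) ν^{r̃−2}) ≥ 0. If moreover either (0 < r̃ < 1 and η̃ > 0) or (r̃ < 0), then G₀ is convex on the convex open region {(x, ν) : 0 < ν < ϑ̃ (η̃/(r̃·|r̃ − 1|))^{1/r̃}}. -/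
open Real

/-- `G₀(x, ν) = (1/(2ν))‖Fx − y‖₂² + (ν/ϑ̃)^r̃ − η̃ log ν`. -/
noncomputable def gibbsG0 (N M : ℕ) (F : Matrix (Fin M) (Fin N) ℝ) (y : Fin M → ℝ)
    (rt ηt vtht : ℝ) : (Fin N → ℝ) × ℝ → ℝ :=
  fun p =>
    (1 / (2 * p.2)) * ∑ j, (F.mulVec p.1 j - y j) ^ 2
      + (p.2 / vtht) ^ rt
      - ηt * Real.log p.2

open Filter Topology

/-- The second derivative of a `C²` function along a line is its Hessian quadratic form. -/
lemma iteratedFDeriv_two_apply_eq_of_hasDerivAt_line {E : Type*} [NormedAddCommGroup E]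
    [NormedSpace ℝ E] {f : E → ℝ} {z w : E} {g : ℝ → ℝ} {c : ℝ} (hf : ContDiffAt ℝ 2 f z)
    (hg : ∀ᶠ t in 𝓝 (0 : ℝ), HasDerivAt (fun s : ℝ => f (z + s • w)) (g t) t)
    (hc : HasDerivAt g c 0) : iteratedFDeriv ℝ 2 f z ![w, w] = c := by
  have hline : ∀ t : ℝ, HasDerivAt (fun s : ℝ => z + s • w) w t := fun t => by
    simpa using ((hasDerivAt_id t).smul_const w).const_add z
  have hline0 : Tendsto (fun s : ℝ => z + s • w) (𝓝 0) (𝓝 z) := by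
    simpa using (hline 0).continuousAt.tendsto
  have hev : ∀ᶠ t in 𝓝 (0 : ℝ), fderiv ℝ f (z + t • w) w = g t := by
    have hd : ∀ᶠ p in 𝓝 z, DifferentiableAt ℝ f p := by
      filter_upwards [hf.eventually (by simp)] with p hp
      exact hp.differentiableAt (by norm_num)
    filter_upwards [hline0.eventually hd, hg] with t ht hgt
    exact (ht.hasFDerivAt.comp_hasDerivAt t (hline t)).unique hgt
  have h2 : DifferentiableAt ℝ (fderiv ℝ f) (z + (0 : ℝ) • w) := by
    simpa using (hf.fderiv_right (m := 1) (by norm_num)).differentiableAt (by norm_num)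
  have h1 : HasDerivAt (fun t : ℝ => fderiv ℝ f (z + t • w))
      (fderiv ℝ (fderiv ℝ f) (z + (0 : ℝ) • w) w) 0 :=
    h2.hasFDerivAt.comp_hasDerivAt (0 : ℝ) (hline 0)
  have h3 : HasDerivAt (fun t : ℝ => fderiv ℝ f (z + t • w) w)
      (fderiv ℝ (fderiv ℝ f) (z + (0 : ℝ) • w) w w) 0 := by
    simpa using h1.clm_apply (hasDerivAt_const (0 : ℝ) w)
  have h4 := h3.unique (hc.congr_of_eventuallyEq hev)
  rw [iteratedFDeriv_two_apply]
  simpa using h4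

/-- Joint convexity of the quadratic-over-linear function. -/
lemma convexOn_sq_div : ConvexOn ℝ {p : ℝ × ℝ | 0 < p.2} (fun p => p.1 ^ 2 / p.2) := by
  refine ⟨convex_halfSpace_gt (LinearMap.snd ℝ ℝ ℝ).isLinear 0, ?_⟩
  rintro ⟨a, s⟩ hs ⟨b, t⟩ ht α β hα hβ hαβ
  simp only [Set.mem_ofPred_eq] at hs ht
  have hpos : 0 < α * s + β * t := by
    rcases hα.eq_or_lt with rfl | hα
    · simp_all
    · positivity
  simp only [Prod.smul_mk, Prod.mk_add_mk, smul_eq_mul]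
  rw [div_le_iff₀ hpos]
  have hdiff : (α * (a ^ 2 / s) + β * (b ^ 2 / t)) * (α * s + β * t) - (α * a + β * b) ^ 2
      = α * β * (a * t - b * s) ^ 2 / (s * t) := by
    field_simp
    ring
  have : 0 ≤ α * β * (a * t - b * s) ^ 2 / (s * t) := by positivity
  linarith

lemma hasDerivAt_rpow_sub_log {r η θ s : ℝ} (hθ : 0 < θ) (hs : 0 < s) :
    HasDerivAt (fun s : ℝ => (s / θ) ^ r - η * Real.log s)
      (r / θ * (s / θ) ^ (r - 1) - η / s) s := by
  have h1 := ((hasDerivAt_id s).div_const θ).rpow_const (p := r) (Or.inl (div_pos hs hθ).ne')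
  refine (h1.sub ((Real.hasDerivAt_log hs.ne').const_mul η)).congr_deriv ?_
  simp only [id]
  ring

lemma hasDerivAt_deriv_rpow_sub_log {r η θ s : ℝ} (hθ : 0 < θ) (hs : 0 < s) :
    HasDerivAt (fun s : ℝ => r / θ * (s / θ) ^ (r - 1) - η / s)
      (η / s ^ 2 + r * (r - 1) / θ ^ r * s ^ (r - 2)) s := by
  have h1 := ((hasDerivAt_id s).div_const θ).rpow_const (p := r - 1)
    (Or.inl (div_pos hs hθ).ne')
  refine ((h1.const_mul (r / θ)).sub ((hasDerivAt_const s η).div (hasDerivAt_id s)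
    hs.ne')).congr_deriv ?_
  have hpow : θ ^ r = θ ^ (r - 2) * θ ^ 2 := by
    rw [← Real.rpow_natCast, ← Real.rpow_add hθ]
    norm_num
  simp only [id]
  rw [show r - 1 - 1 = r - 2 by ring, Real.div_rpow hs.le hθ.le, hpow]
  field_simp
  ring

lemma div_sq_add_rpow_eq {r η θ s : ℝ} (hθ : 0 < θ) (hs : 0 < s) :
    η / s ^ 2 + r * (r - 1) / θ ^ r * s ^ (r - 2) = (η + r * (r - 1) * (s / θ) ^ r) / s ^ 2 := by
  have hpow : s ^ r = s ^ (r - 2) * s ^ 2 := by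
    rw [← Real.rpow_natCast, ← Real.rpow_add hs]
    norm_num
  rw [Real.div_rpow hs.le hθ.le, hpow]
  field_simp

/-- `G₀` is convex over every convex open set of positive `ν` on which
`η + r(r-1)(ν/θ)^r` is nonnegative. -/
lemma convexOn_gibbsG0 (N M : ℕ) (F : Matrix (Fin M) (Fin N) ℝ) (y : Fin M → ℝ)
    {r η θ : ℝ} (hθ : 0 < θ) {D : Set ℝ} (hD : Convex ℝ D) (hDo : IsOpen D)
    (hpos : ∀ s ∈ D, 0 < s) (hnn : ∀ s ∈ D, 0 ≤ η + r * (r - 1) * (s / θ) ^ r) :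
    ConvexOn ℝ {p : (Fin N → ℝ) × ℝ | p.2 ∈ D} (gibbsG0 N M F y r η θ) := by
  have hconv : Convex ℝ {p : (Fin N → ℝ) × ℝ | p.2 ∈ D} :=
    hD.linear_preimage (LinearMap.snd ℝ (Fin N → ℝ) ℝ)
  have hφ : ConvexOn ℝ D (fun s : ℝ => (s / θ) ^ r - η * Real.log s) := by
    refine convexOn_of_hasDerivWithinAt2_nonneg hD
      (fun s hs => (hasDerivAt_rpow_sub_log hθ (hpos s hs)).continuousAt.continuousWithinAt)
      (f' := fun s => r / θ * (s / θ) ^ (r - 1) - η / s)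
      (f'' := fun s => η / s ^ 2 + r * (r - 1) / θ ^ r * s ^ (r - 2)) ?_ ?_ ?_
    all_goals
      rw [hDo.interior_eq]
      intro s hs
    · exact (hasDerivAt_rpow_sub_log hθ (hpos s hs)).hasDerivWithinAt
    · exact (hasDerivAt_deriv_rpow_sub_log hθ (hpos s hs)).hasDerivWithinAt
    · rw [div_sq_add_rpow_eq hθ (hpos s hs)]
      exact div_nonneg (hnn s hs) (sq_nonneg s)
  refine ⟨hconv, fun p hp q hq α β hα hβ hαβ => ?_⟩
  have h1 := hφ.2 hp hq hα hβ hαβ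
  have h2 : ∑ j, (F.mulVec (α • p + β • q).1 j - y j) ^ 2 / (α • p + β • q).2 ≤
      ∑ j, (α * ((F.mulVec p.1 j - y j) ^ 2 / p.2) + β * ((F.mulVec q.1 j - y j) ^ 2 / q.2)) := by
    refine Finset.sum_le_sum fun j _ => ?_
    have h := convexOn_sq_div.2 (x := (F.mulVec p.1 j - y j, p.2)) (hpos _ hp)
      (y := (F.mulVec q.1 j - y j, q.2)) (hpos _ hq) hα hβ hαβ
    have hy : F.mulVec (α • p + β • q).1 j - y j =
        α * (F.mulVec p.1 j - y j) + β * (F.mulVec q.1 j - y j) := by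
      simp only [Prod.fst_add, Prod.smul_fst, Matrix.mulVec_add, Matrix.mulVec_smul, Pi.add_apply,
        Pi.smul_apply, smul_eq_mul]
      linear_combination y j * hαβ
    rw [hy]
    simpa using h
  rw [Finset.sum_add_distrib, ← Finset.mul_sum, ← Finset.mul_sum, ← Finset.sum_div,
    ← Finset.sum_div, ← Finset.sum_div] at h2
  have heq : ∀ p : (Fin N → ℝ) × ℝ, gibbsG0 N M F y r η θ p =
      (∑ j, (F.mulVec p.1 j - y j) ^ 2) / p.2 / 2 + ((p.2 / θ) ^ r - η * Real.log p.2) := by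
    intro p
    simp only [gibbsG0]
    ring
  rw [heq, heq, heq]
  simp only [smul_eq_mul, Prod.snd_add, Prod.smul_snd] at h1 h2 ⊢
  linarith

lemma hasDerivAt_sq_div_line {a b ν v t : ℝ} (h : 0 < ν + t * v) :
    HasDerivAt (fun t => 1 / (2 * (ν + t * v)) * (a + t * b) ^ 2)
      ((a + t * b) * b / (ν + t * v) - v * (a + t * b) ^ 2 / (2 * (ν + t * v) ^ 2)) t := by
  have hν := ((hasDerivAt_id t).mul_const v).const_add ν
  have ha := ((hasDerivAt_id t).mul_const b).const_add a
  refine (((hasDerivAt_const t (1 : ℝ)).fun_div (hν.const_mul 2) (by simpa using h.ne')).fun_mul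
    (ha.fun_pow 2)).congr_deriv ?_
  simp only [id]
  field_simp
  push_cast
  ring

lemma hasDerivAt_deriv_sq_div_line {a b ν v : ℝ} (h : 0 < ν) :
    HasDerivAt (fun t : ℝ =>
        (a + t * b) * b / (ν + t * v) - v * (a + t * b) ^ 2 / (2 * (ν + t * v) ^ 2))
      (ν⁻¹ * (b - v * ν⁻¹ * a) ^ 2) 0 := by
  have hν := ((hasDerivAt_id (0 : ℝ)).mul_const v).const_add ν
  have ha := ((hasDerivAt_id (0 : ℝ)).mul_const b).const_add a
  refine (((ha.mul_const b).fun_div hν (by simpa using h.ne')).sub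
    (((ha.fun_pow 2).const_mul v).fun_div ((hν.fun_pow 2).const_mul 2)
      (by simpa using h.ne'))).congr_deriv ?_
  simp only [id]
  simp
  field_simp

lemma contDiffAt_gibbsG0 (N M : ℕ) (F : Matrix (Fin M) (Fin N) ℝ) (y : Fin M → ℝ)
    {r η θ : ℝ} (hθ : 0 < θ) {p : (Fin N → ℝ) × ℝ} (hp : 0 < p.2) :
    ContDiffAt ℝ 2 (gibbsG0 N M F y r η θ) p := by
  have hF : ∀ j, ContDiffAt ℝ 2 (fun p : (Fin N → ℝ) × ℝ => F.mulVec p.1 j) p := fun j => by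
    simp only [Matrix.mulVec, dotProduct]
    fun_prop
  unfold gibbsG0
  refine ContDiffAt.sub (ContDiffAt.add (ContDiffAt.mul ?_ ?_) ?_) ?_
  · exact contDiffAt_const.div (contDiffAt_const.mul contDiffAt_snd) (by positivity)
  · exact ContDiffAt.sum fun j _ => ((hF j).sub contDiffAt_const).pow 2
  · exact (contDiffAt_snd.div_const θ).rpow_const_of_ne (by positivity)
  · exact contDiffAt_const.mul (contDiffAt_snd.log hp.ne')

lemma iteratedFDeriv_two_gibbsG0 (N M : ℕ) (F : Matrix (Fin M) (Fin N) ℝ) (y : Fin M → ℝ)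
    {r η θ : ℝ} (hθ : 0 < θ) (x : Fin N → ℝ) {ν : ℝ} (hν : 0 < ν) (u : Fin N → ℝ) (v : ℝ) :
    iteratedFDeriv ℝ 2 (gibbsG0 N M F y r η θ) (x, ν) ![(u, v), (u, v)] =
      ν⁻¹ * ∑ j, (F.mulVec u j - v * ν⁻¹ * (F.mulVec x j - y j)) ^ 2
        + v ^ 2 * (η / ν ^ 2 + (r * (r - 1) / θ ^ r) * ν ^ (r - 2)) := by
  have hline : ∀ t : ℝ, HasDerivAt (fun t : ℝ => ν + t * v) v t := fun t => by
    simpa using ((hasDerivAt_id t).mul_const v).const_add ν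
  refine iteratedFDeriv_two_apply_eq_of_hasDerivAt_line
    (g := fun t => ∑ j, (((F.mulVec x j - y j) + t * F.mulVec u j) * F.mulVec u j / (ν + t * v)
        - v * ((F.mulVec x j - y j) + t * F.mulVec u j) ^ 2 / (2 * (ν + t * v) ^ 2))
      + (r / θ * ((ν + t * v) / θ) ^ (r - 1) - η / (ν + t * v)) * v)
    (contDiffAt_gibbsG0 N M F y hθ hν) ?_ ?_
  · have hev : ∀ᶠ t in 𝓝 (0 : ℝ), 0 < ν + t * v :=
      (hline 0).continuousAt.eventually (lt_mem_nhds (by simpa using hν))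
    filter_upwards [hev] with t ht
    have h1 := HasDerivAt.fun_sum (u := Finset.univ) fun (j : Fin M) _ =>
      hasDerivAt_sq_div_line (a := F.mulVec x j - y j) (b := F.mulVec u j) ht
    have h2 := (hasDerivAt_rpow_sub_log (r := r) (η := η) hθ ht).comp t (hline t)
    refine (h1.add h2).congr_of_eventuallyEq (.of_forall fun s => ?_)
    simp only [gibbsG0, Prod.smul_mk, Prod.mk_add_mk, smul_eq_mul, Matrix.mulVec_add,
      Matrix.mulVec_smul, Pi.add_apply, Pi.smul_apply, Function.comp_apply, Finset.mul_sum,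
      sub_add_eq_add_sub]
    exact add_sub_assoc _ _ _
  · have h1 := HasDerivAt.fun_sum (u := Finset.univ) fun (j : Fin M) _ =>
      hasDerivAt_deriv_sq_div_line (a := F.mulVec x j - y j) (b := F.mulVec u j) (v := v) hν
    have h2 := (HasDerivAt.comp (0 : ℝ) (hasDerivAt_deriv_rpow_sub_log (r := r) (η := η)
      (s := ν + 0 * v) hθ (by simpa using hν)) (hline 0)).mul_const v
    refine (h1.add h2).congr_deriv ?_
    rw [Finset.mul_sum, zero_mul, add_zero]
    ring

/-- If `r̃ ≥ 1` and `η̃ = r̃β̃ − (M+2)/2 > 0`, then `G₀` is convex on `ℝ^N × ℝ_{++}`;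
in particular the Hessian quadratic form at `(x, ν)` applied to `(u, v)` equals
`ν⁻¹‖Fu − vν⁻¹(Fx − y)‖₂² + v²(η̃ν⁻² + (r̃(r̃−1)/ϑ̃^r̃)ν^{r̃−2}) ≥ 0`. If instead
`(0 < r̃ < 1 ∧ η̃ > 0)` or `r̃ < 0`, then `G₀` is convex on the region
`{(x, ν) : 0 < ν < ϑ̃ (η̃/(r̃|r̃−1|))^{1/r̃}}`. -/
theorem statement16 (N M : ℕ) (hN : 0 < N) (hM : 0 < M)
    (F : Matrix (Fin M) (Fin N) ℝ) (y : Fin M → ℝ)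
    (rt βt ηt vtht : ℝ) (hrt0 : rt ≠ 0) (hβt : 0 < βt)
    (hηt_def : ηt = rt * βt - (M + 2 : ℝ) / 2) (hvtht : 0 < vtht) :
    ((1 ≤ rt ∧ 0 < ηt) →
      ConvexOn ℝ {p : (Fin N → ℝ) × ℝ | 0 < p.2} (gibbsG0 N M F y rt ηt vtht) ∧
      ∀ (x : Fin N → ℝ) (ν : ℝ), 0 < ν → ∀ (u : Fin N → ℝ) (v : ℝ),
        (iteratedFDeriv ℝ 2 (gibbsG0 N M F y rt ηt vtht) (x, ν) ![(u, v), (u, v)] =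
          ν⁻¹ * ∑ j, (F.mulVec u j - v * ν⁻¹ * (F.mulVec x j - y j)) ^ 2
            + v ^ 2 * (ηt / ν ^ 2 + (rt * (rt - 1) / vtht ^ rt) * ν ^ (rt - 2))) ∧
        (0 ≤ ν⁻¹ * ∑ j, (F.mulVec u j - v * ν⁻¹ * (F.mulVec x j - y j)) ^ 2
            + v ^ 2 * (ηt / ν ^ 2 + (rt * (rt - 1) / vtht ^ rt) * ν ^ (rt - 2)))) ∧
    (((0 < rt ∧ rt < 1 ∧ 0 < ηt) ∨ rt < 0) →
      ConvexOn ℝ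
        {p : (Fin N → ℝ) × ℝ | 0 < p.2 ∧ p.2 < vtht * (ηt / (rt * |rt - 1|)) ^ (1 / rt)}
        (gibbsG0 N M F y rt ηt vtht)) := by
  refine ⟨fun ⟨hr, hη⟩ => ⟨?_, fun x ν hν u v =>
    ⟨iteratedFDeriv_two_gibbsG0 N M F y hvtht x hν u v, ?_⟩⟩, fun h => ?_⟩
  · refine convexOn_gibbsG0 N M F y hvtht (convex_Ioi 0) isOpen_Ioi (fun s hs => hs)
      fun s hs => ?_
    have hs' : 0 < s := hs
    have : 0 ≤ rt - 1 := by linarith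
    positivity
  · have : 0 ≤ rt - 1 := by linarith
    have : 0 < rt := by linarith
    positivity
  · refine convexOn_gibbsG0 N M F y hvtht (convex_Ioo 0 _) isOpen_Ioo (fun s hs => hs.1)
      fun s hs => ?_
    have hs0 : 0 < s / vtht := div_pos hs.1 hvtht
    have hs1 : s / vtht < (ηt / (rt * |rt - 1|)) ^ (1 / rt) := by
      rw [div_lt_iff₀' hvtht]
      exact hs.2
    rcases h with ⟨hr0, hr1, hη⟩ | hr
    · rw [abs_of_neg (by linarith)] at hs1
      have hden : 0 < rt * -(rt - 1) := mul_pos hr0 (by linarith)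
      have h := Real.rpow_le_rpow hs0.le hs1.le hr0.le
      rw [← Real.rpow_mul (by positivity), one_div_mul_cancel hrt0, Real.rpow_one,
        le_div_iff₀ hden] at h
      linarith
    · rw [abs_of_neg (by linarith)] at hs1
      have hη : ηt < 0 := by
        have := mul_neg_of_neg_of_pos hr hβt
        have : (0 : ℝ) ≤ M := M.cast_nonneg
        linarith
      have hden : rt * -(rt - 1) < 0 := mul_neg_of_neg_of_pos hr (by linarith)
      have h := Real.rpow_le_rpow_of_nonpos hs0 hs1.le hr.le
      rw [← Real.rpow_mul (div_pos_of_neg_of_neg hη hden).le, one_div_mul_cancel hrt0,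
        Real.rpow_one, div_le_iff_of_neg hden] at h
      linarith
end

section
/- Let r > 0, η > 0, ϑ > 0 and t ∈ ℝ. If θ* > 0 is a minimizer over (0, ∞) of the function f(θ) = t²/(2θ) + (θ/ϑ)^r − η log θ, then θ* ≥ ϑ (η/r)^{1/r}. -/
open Real

/-- Let `r > 0`, `η > 0`, `ϑ > 0` and `t ∈ ℝ`. If `θ* > 0` minimizes
`f(θ) = t²/(2θ) + (θ/ϑ)^r − η log θ` over `(0, ∞)`, then `θ* ≥ ϑ (η/r)^{1/r}`. -/
theorem statement17 (r η vth t : ℝ) (hr : 0 < r) (hη : 0 < η) (hvth : 0 < vth)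
    (θs : ℝ) (hθs : 0 < θs)
    (hmin : ∀ θ : ℝ, 0 < θ →
      t ^ 2 / (2 * θs) + (θs / vth) ^ r - η * Real.log θs ≤
        t ^ 2 / (2 * θ) + (θ / vth) ^ r - η * Real.log θ) :
    vth * (η / r) ^ (1 / r) ≤ θs := by
  by_contra! hlt
  have hc : 0 < η / r := div_pos hη hr
  set m := vth * (η / r) ^ (1 / r) with hm
  have hm0 : 0 < m := hθs.trans hlt
  have hmc : (m / vth) ^ r = η / r := by
    rw [hm, mul_div_cancel_left₀ _ hvth.ne', ← Real.rpow_mul hc.le, one_div_mul_cancel hr.ne',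
      Real.rpow_one]
  have hu : 0 < (θs / vth) ^ r := Real.rpow_pos_of_pos (div_pos hθs hvth) r
  have huc : (θs / vth) ^ r < η / r := by
    rw [← hmc]
    exact Real.rpow_lt_rpow (div_pos hθs hvth).le (div_lt_div_of_pos_right hlt hvth) hr
  have hlogu : Real.log ((θs / vth) ^ r) = r * (Real.log θs - Real.log vth) := by
    rw [Real.log_rpow (div_pos hθs hvth), Real.log_div hθs.ne' hvth.ne']
  have hlogc : Real.log (η / r) = r * (Real.log m - Real.log vth) := by
    rw [← hmc, Real.log_rpow (div_pos hm0 hvth), Real.log_div hm0.ne' hvth.ne']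
  have hlog := Real.log_lt_sub_one_of_pos (div_pos hu hc) ((div_lt_one hc).2 huc).ne
  rw [Real.log_div hu.ne' hc.ne', hlogu, hlogc] at hlog
  have hstrict : η * Real.log θs - η * Real.log m < (θs / vth) ^ r - η / r := by
    calc η * Real.log θs - η * Real.log m
        = η / r * (r * (Real.log θs - Real.log vth) - r * (Real.log m - Real.log vth)) := by
          field_simp
          ring
      _ < η / r * ((θs / vth) ^ r / (η / r) - 1) := mul_lt_mul_of_pos_left hlog hc
      _ = (θs / vth) ^ r - η / r := by rw [mul_sub, mul_div_cancel₀ _ hc.ne', mul_one]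
  have hquad : t ^ 2 / (2 * m) ≤ t ^ 2 / (2 * θs) := by gcongr
  have hcmp := hmin m hm0
  rw [hmc] at hcmp
  linarith
end

section
/- Let r̃ > 0, η̃ > 0, ϑ̃ > 0 and a ≥ 0. Then the function h(ν) = a/(2ν) + (ν/ϑ̃)^{r̃} − η̃ log ν attains its infimum over (0, ∞), and the minimizer is unique; equivalently, there is exactly one ν* > 0 satisfying the stationarity equation r̃ (ν*/ϑ̃)^{r̃} = η̃ + a/(2ν*), and it is the unique global minimizer of h on (0, ∞). -/
open Real

/-- The stationarity equation `r (ν/ϑ)^r = η + a/(2ν)` has a positive solution. -/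
lemma exists_pos_stationary {r η ϑ a : ℝ} (hr : 0 < r) (hη : 0 < η) (hϑ : 0 < ϑ) (ha : 0 ≤ a) :
    ∃ ν : ℝ, 0 < ν ∧ r * (ν / ϑ) ^ r = η + a / (2 * ν) := by
  have key : ∀ c : ℝ, 0 < c → r * (ϑ * (c / r) ^ r⁻¹ / ϑ) ^ r = c := by
    intro c hc
    rw [mul_div_cancel_left₀ _ hϑ.ne', Real.rpow_inv_rpow (by positivity) hr.ne',
      mul_div_cancel₀ _ hr.ne']
  set ν₁ : ℝ := ϑ * (η / r) ^ r⁻¹ with hν₁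
  have hpos₁ : 0 < ν₁ := by positivity
  have hA : 0 ≤ a / (2 * ν₁) := by positivity
  set ν₂ : ℝ := ϑ * ((η + a / (2 * ν₁)) / r) ^ r⁻¹ with hν₂
  have hle : ν₁ ≤ ν₂ := by
    rw [hν₂]
    nth_rewrite 1 [hν₁]
    gcongr
    linarith
  have hcont : ContinuousOn (fun ν : ℝ => r * (ν / ϑ) ^ r - a / (2 * ν)) (Set.Icc ν₁ ν₂) := by
    refine ContinuousOn.sub ?_ ?_
    · exact continuousOn_const.mul
        ((continuousOn_id.div_const ϑ).rpow_const fun _ _ => Or.inr hr.le)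
    · refine continuousOn_const.div (by fun_prop) fun ν hν => ?_
      have := hpos₁.trans_le hν.1
      positivity
  have hmem : η ∈ Set.Icc (r * (ν₁ / ϑ) ^ r - a / (2 * ν₁)) (r * (ν₂ / ϑ) ^ r - a / (2 * ν₂)) := by
    have h₁ : r * (ν₁ / ϑ) ^ r = η := key η hη
    have h₂ : r * (ν₂ / ϑ) ^ r = η + a / (2 * ν₁) := key _ (by positivity)
    have h₃ : a / (2 * ν₂) ≤ a / (2 * ν₁) := by gcongr
    rw [h₁, h₂]
    constructor <;> linarith
  obtain ⟨ν, hν, hf⟩ := intermediate_value_Icc hle hcont hmem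
  exact ⟨ν, hpos₁.trans_le hν.1, by dsimp only at hf; linarith⟩

/-- A stationary point of `ν ↦ a/(2ν) + (ν/ϑ)^r − η log ν` is a strict global minimizer on
`(0, ∞)`: in the variable `t = log (ν/μ)` this is `exp x ≥ x + 1`, strictly for `x ≠ 0`. -/
lemma objective_lt_of_stationary {r η ϑ a μ ν : ℝ} (hr : 0 < r) (hϑ : 0 < ϑ) (ha : 0 ≤ a)
    (hμ : 0 < μ) (hstat : r * (μ / ϑ) ^ r = η + a / (2 * μ)) (hν : 0 < ν) (hne : ν ≠ μ) :
    a / (2 * μ) + (μ / ϑ) ^ r - η * Real.log μ < a / (2 * ν) + (ν / ϑ) ^ r - η * Real.log ν := by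
  obtain ⟨t, rfl⟩ : ∃ t, ν = μ * Real.exp t :=
    ⟨Real.log (ν / μ), by rw [Real.exp_log (by positivity), mul_div_cancel₀ _ hμ.ne']⟩
  have ht : t ≠ 0 := by
    rintro rfl
    simp at hne
  have hlog : Real.log (μ * Real.exp t) = Real.log μ + t := by
    rw [Real.log_mul hμ.ne' (Real.exp_pos t).ne', Real.log_exp]
  have hpow : (μ * Real.exp t / ϑ) ^ r = (μ / ϑ) ^ r * Real.exp (t * r) := by
    rw [mul_div_right_comm, Real.mul_rpow (by positivity) (Real.exp_pos t).le, Real.exp_mul]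
  have hfrac : a / (2 * (μ * Real.exp t)) = a / (2 * μ) * Real.exp (-t) := by
    rw [Real.exp_neg, ← mul_assoc, ← div_div, div_eq_mul_inv _ (Real.exp t)]
  have hA : 0 ≤ a / (2 * μ) := by positivity
  have hB : 0 < (μ / ϑ) ^ r := by positivity
  have h₁ := mul_le_mul_of_nonneg_left (Real.add_one_le_exp (-t)) hA
  have h₂ := mul_lt_mul_of_pos_left (Real.add_one_lt_exp (mul_ne_zero ht hr.ne')) hB
  rw [hlog, hpow, hfrac]
  linear_combination h₁ + h₂ - t * hstat

/-- Let `r̃, η̃, ϑ̃ > 0` and `a ≥ 0`. Then `h(ν) = a/(2ν) + (ν/ϑ̃)^r̃ − η̃ log ν`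
attains its infimum over `(0, ∞)` at a unique minimizer; equivalently there is exactly
one `ν* > 0` satisfying the stationarity equation `r̃ (ν*/ϑ̃)^r̃ = η̃ + a/(2ν*)`, and it
is the unique global minimizer of `h` on `(0, ∞)`. -/
theorem statement18 (rt ηt vtht a : ℝ)
    (hrt : 0 < rt) (hηt : 0 < ηt) (hvtht : 0 < vtht) (ha : 0 ≤ a) :
    ∃ νs : ℝ, 0 < νs ∧
      (rt * (νs / vtht) ^ rt = ηt + a / (2 * νs)) ∧
      (∀ ν : ℝ, 0 < ν → rt * (ν / vtht) ^ rt = ηt + a / (2 * ν) → ν = νs) ∧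
      (∀ ν : ℝ, 0 < ν →
        a / (2 * νs) + (νs / vtht) ^ rt - ηt * Real.log νs ≤
          a / (2 * ν) + (ν / vtht) ^ rt - ηt * Real.log ν) ∧
      (∀ ν : ℝ, 0 < ν → ν ≠ νs →
        a / (2 * νs) + (νs / vtht) ^ rt - ηt * Real.log νs <
          a / (2 * ν) + (ν / vtht) ^ rt - ηt * Real.log ν) := by
  obtain ⟨νs, hpos, hstat⟩ := exists_pos_stationary hrt hηt hvtht ha
  have hlt := fun ν (hν : 0 < ν) (hne : ν ≠ νs) =>
    objective_lt_of_stationary hrt hvtht ha hpos hstat hν hne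
  refine ⟨νs, hpos, hstat, fun ν hν hνstat => ?_, fun ν hν => ?_, hlt⟩
  · by_contra hne
    exact lt_asymm (hlt ν hν hne)
      (objective_lt_of_stationary hrt hvtht ha hν hνstat hpos (Ne.symm hne))
  · rcases eq_or_ne ν νs with rfl | hne
    · exact le_rfl
    · exact (hlt ν hν hne).le
end
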